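/- Let M be an irreducible generator on a finite set Z with |Z| ≥ 2 and let δ ∈ (0,1). Then there exists α_* > 0 (depending only on M and δ) such that for every μ₀ ∈ P(Z), every ζ₀ ∈ P(Z), and every pair of solutions μ, ζ : [0,∞) → (Z → ℝ) of the forward Kolmogorov equation d/dt μ_t = Mᵀ μ_t, d/dt ζ_t = Mᵀ ζ_t with μ_0 = μ₀ and ζ_0 = ζ₀ the following hold: (i) ζ_t ∈ P_+(Z) for every t > 0; (ii) 0 < α_* ≤ α_gLSI(ζ_t, M) ≤ 2 α_gPI(ζ_t, M) for every t ≥ δ; (iii) if moreover ζ₀ ∈ P_+(Z), then for all t ≥ 0, var_{ζ_t}(μ_t/ζ_t) ≤ var_{ζ₀}(μ₀/ζ₀) · min(1, exp(−α_*(t − δ))) and H_{ζ_t}(μ_t/ζ_t) ≤ H_{ζ₀}(μ₀/ζ₀) · min(1, exp(−α_*(t − δ))), where in H the convention x·log x = 0 at x = 0 is used. -/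

import Mathlib

open Finset Filter

/-- A generator (transition rate matrix) on a finite state space `Z`. -/
def IsGenerator {Z : Type*} [Fintype Z] (M : Z → Z → ℝ) : Prop :=
  (∀ z z' : Z, z ≠ z' → 0 ≤ M z z') ∧ ∀ z : Z, ∑ z' : Z, M z z' = 0

/-- Irreducibility of a generator. -/
def IsIrreducibleGen {Z : Type*} [Fintype Z] (M : Z → Z → ℝ) : Prop :=
  ∀ z z' : Z, z ≠ z' → ∃ (ℓ : ℕ) (p : ℕ → Z), 1 ≤ ℓ ∧ p 0 = z ∧ p ℓ = z' ∧
    ∀ i : ℕ, 1 ≤ i → i ≤ ℓ → 0 < M (p (i - 1)) (p i)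

/-- A probability measure on `Z`. -/
def IsProb {Z : Type*} [Fintype Z] (ζ : Z → ℝ) : Prop :=
  (∀ z, 0 ≤ ζ z) ∧ ∑ z : Z, ζ z = 1

/-- A strictly positive probability measure on `Z`. -/
def IsPosProb {Z : Type*} [Fintype Z] (ζ : Z → ℝ) : Prop :=
  (∀ z, 0 < ζ z) ∧ ∑ z : Z, ζ z = 1

/-- Expectation of `f` with respect to `ζ`. -/
noncomputable def expec {Z : Type*} [Fintype Z] (ζ f : Z → ℝ) : ℝ := ∑ z : Z, f z * ζ z

/-- Variance of `f` with respect to `ζ`. -/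
noncomputable def varWrt {Z : Type*} [Fintype Z] (ζ f : Z → ℝ) : ℝ :=
  expec ζ (fun z => f z ^ 2) - (expec ζ f) ^ 2

/-- Generalised Dirichlet form with respect to `ζ`. -/
noncomputable def dirichletForm {Z : Type*} [Fintype Z] (ζ f : Z → ℝ) (M : Z → Z → ℝ) : ℝ :=
  (1 / 2) * ∑ z : Z, ∑ z' : Z, M z z' * ζ z * (f z - f z') ^ 2

/-- A (strictly positive) probability density with respect to `ζ`. -/
def IsDensity {Z : Type*} [Fintype Z] (ζ φ : Z → ℝ) : Prop :=
  (∀ z, 0 < φ z) ∧ expec ζ φ = 1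

/-- Relative entropy with respect to `ζ`. -/
noncomputable def relEnt {Z : Type*} [Fintype Z] (ζ φ : Z → ℝ) : ℝ :=
  ∑ z : Z, φ z * Real.log (φ z) * ζ z

/-- Generalised Fisher information with respect to `ζ`. -/
noncomputable def fisherInfo {Z : Type*} [Fintype Z] (ζ φ : Z → ℝ) (M : Z → Z → ℝ) : ℝ :=
  ∑ z : Z, ∑ z' : Z, M z z' * ζ z * φ z * (φ z' / φ z - 1 - Real.log (φ z' / φ z))

/-- `f` is a nonconstant function. -/
def Nonconst {Z : Type*} (f : Z → ℝ) : Prop := ∃ z z' : Z, f z ≠ f z'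

/-- Generalised Poincaré constant. -/
noncomputable def gPI {Z : Type*} [Fintype Z] (ζ : Z → ℝ) (M : Z → Z → ℝ) : ℝ :=
  sInf { r : ℝ | ∃ f : Z → ℝ, Nonconst f ∧ r = dirichletForm ζ f M / varWrt ζ f }

/-- Generalised log-Sobolev constant. -/
noncomputable def gLSI {Z : Type*} [Fintype Z] (ζ : Z → ℝ) (M : Z → Z → ℝ) : ℝ :=
  sInf { r : ℝ | ∃ φ : Z → ℝ, IsDensity ζ φ ∧ φ ≠ (fun _ => 1) ∧
    r = fisherInfo ζ φ M / relEnt ζ φ }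

section FunctionalInequalities

variable {Z : Type*} [Fintype Z] {M : Z → Z → ℝ} {ζ f φ : Z → ℝ}

theorem varWrt_eq_sum_sub_sq (hζ : ∑ z, ζ z = 1) (f : Z → ℝ) (a : ℝ) :
    varWrt ζ f = ∑ z, ζ z * (f z - a) ^ 2 - (expec ζ f - a) ^ 2 := by
  have h : ∑ z, ζ z * (f z - a) ^ 2
      = expec ζ (fun z => f z ^ 2) - 2 * a * expec ζ f + a ^ 2 * ∑ z, ζ z := by
    simp only [expec, mul_sum, ← sum_sub_distrib, ← sum_add_distrib]
    exact sum_congr rfl fun z _ => by ring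
  rw [h, hζ, varWrt]
  ring

theorem varWrt_nonneg (hζ : IsPosProb ζ) (f : Z → ℝ) : 0 ≤ varWrt ζ f := by
  rw [varWrt_eq_sum_sub_sq hζ.2 f (expec ζ f), sub_self, zero_pow two_ne_zero, sub_zero]
  exact sum_nonneg fun z _ => mul_nonneg (hζ.1 z).le (sq_nonneg _)

theorem varWrt_pos (hζ : IsPosProb ζ) (hf : Nonconst f) : 0 < varWrt ζ f := by
  rw [varWrt_eq_sum_sub_sq hζ.2 f (expec ζ f), sub_self, zero_pow two_ne_zero, sub_zero]
  obtain ⟨a, b, hab⟩ := hf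
  obtain ⟨z, hz⟩ : ∃ z, f z ≠ expec ζ f := by
    by_contra! h
    exact hab ((h a).trans (h b).symm)
  exact sum_pos' (fun z _ => mul_nonneg (hζ.1 z).le (sq_nonneg _))
    ⟨z, mem_univ z, mul_pos (hζ.1 z) (sq_pos_of_ne_zero (sub_ne_zero.2 hz))⟩

theorem sub_one_lt_mul_log {x : ℝ} (hx : 0 < x) (hx1 : x ≠ 1) : x - 1 < x * Real.log x := by
  have h := Real.log_lt_sub_one_of_pos (inv_pos.2 hx) (by simpa using hx1)
  rw [Real.log_inv] at h
  have := mul_lt_mul_of_pos_left h hx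
  rw [mul_sub, mul_inv_cancel₀ hx.ne'] at this
  linarith

theorem sub_one_le_mul_log {x : ℝ} (hx : 0 ≤ x) : x - 1 ≤ x * Real.log x := by
  rcases hx.eq_or_lt with rfl | hx
  · simp
  rcases eq_or_ne x 1 with rfl | h
  · simp
  · exact (sub_one_lt_mul_log hx h).le

theorem relEnt_pos (hζ : IsPosProb ζ) (hφ : IsDensity ζ φ) (hne : φ ≠ fun _ => 1) :
    0 < relEnt ζ φ := by
  have h0 : ∑ z, (φ z - 1) * ζ z = 0 := by
    have := hφ.2
    simp only [expec] at this
    simp only [sub_mul, one_mul, sum_sub_distrib, this, hζ.2, sub_self]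
  obtain ⟨z, hz⟩ := Function.ne_iff.1 hne
  rw [← h0]
  refine sum_lt_sum (fun z _ => ?_)
    ⟨z, mem_univ z, mul_lt_mul_of_pos_right (sub_one_lt_mul_log (hφ.1 z) hz) (hζ.1 z)⟩
  exact mul_le_mul_of_nonneg_right (sub_one_le_mul_log (hφ.1 z).le) (hζ.1 z).le

theorem relEnt_le_varWrt (hζ : IsPosProb ζ) (hφ : IsDensity ζ φ) :
    relEnt ζ φ ≤ varWrt ζ φ := by
  have h : varWrt ζ φ = ∑ z, φ z * (φ z - 1) * ζ z := by
    have h1 : ∑ z, φ z * (φ z - 1) * ζ z = expec ζ (fun z => φ z ^ 2) - expec ζ φ := by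
      simp only [expec, ← sum_sub_distrib]
      exact sum_congr rfl fun z _ => by ring
    rw [h1, varWrt, hφ.2, one_pow]
  rw [h]
  exact sum_le_sum fun z _ => mul_le_mul_of_nonneg_right
    (mul_le_mul_of_nonneg_left (Real.log_le_sub_one_of_pos (hφ.1 z)) (hφ.1 z).le) (hζ.1 z).le

theorem IsGenerator.mul_sq_sub_nonneg (hM : IsGenerator M) (f : Z → ℝ) (z z' : Z) :
    0 ≤ M z z' * (f z - f z') ^ 2 := by
  rcases eq_or_ne z z' with rfl | h
  · simp
  · exact mul_nonneg (hM.1 z z' h) (sq_nonneg _)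

theorem IsIrreducibleGen.reflTransGen (hM : IsIrreducibleGen M) (a b : Z) :
    Relation.ReflTransGen (fun z z' => 0 < M z z') a b := by
  rcases eq_or_ne a b with rfl | hab
  · exact .refl
  obtain ⟨ℓ, p, -, rfl, rfl, hp⟩ := hM a b hab
  suffices ∀ n ≤ ℓ, Relation.ReflTransGen (fun z z' => 0 < M z z') (p 0) (p n) from
    this ℓ le_rfl
  intro n
  induction n with
  | zero => exact fun _ => .refl
  | succ n ih => exact fun hn => (ih (by omega)).tail (hp (n + 1) (by omega) hn)

theorem exists_sq_sub_le_mul_sum (hM : IsGenerator M) (hirr : IsIrreducibleGen M) :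
    ∃ K : ℝ, 0 < K ∧ ∀ (f : Z → ℝ) (a b : Z),
      (f a - f b) ^ 2 ≤ K * ∑ z, ∑ z', M z z' * (f z - f z') ^ 2 := by
  have hS : ∀ f : Z → ℝ, 0 ≤ ∑ z, ∑ z', M z z' * (f z - f z') ^ 2 := fun f =>
    sum_nonneg fun z _ => sum_nonneg fun z' _ => hM.mul_sq_sub_nonneg f z z'
  have key : ∀ a b : Z, ∃ K : ℝ, 0 < K ∧ ∀ f : Z → ℝ,
      (f a - f b) ^ 2 ≤ K * ∑ z, ∑ z', M z z' * (f z - f z') ^ 2 := by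
    intro a b
    induction hirr.reflTransGen a b with
    | refl => exact ⟨1, one_pos, fun f => by simpa using hS f⟩
    | @tail b c _ hbc ih =>
      obtain ⟨K, hK, h⟩ := ih
      refine ⟨2 * K + 2 * (M b c)⁻¹, by positivity, fun f => ?_⟩
      have hle : M b c * (f b - f c) ^ 2 ≤ ∑ z, ∑ z', M z z' * (f z - f z') ^ 2 :=
        (single_le_sum (f := fun z' => M b z' * (f b - f z') ^ 2)
          (fun z' _ => hM.mul_sq_sub_nonneg f b z') (mem_univ c)).trans
        (single_le_sum (f := fun z => ∑ z', M z z' * (f z - f z') ^ 2)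
          (fun z _ => sum_nonneg fun z' _ => hM.mul_sq_sub_nonneg f z z') (mem_univ b))
      have h2 : (f b - f c) ^ 2 ≤ (M b c)⁻¹ * ∑ z, ∑ z', M z z' * (f z - f z') ^ 2 := by
        rwa [inv_mul_eq_div, le_div_iff₀ hbc, mul_comm]
      nlinarith [h f, sq_nonneg ((f a - f b) - (f b - f c))]
  choose K hK h using key
  by_cases hZ : Nonempty Z
  · obtain ⟨z₀⟩ := hZ
    refine ⟨∑ a, ∑ b, K a b, sum_pos (fun a _ => sum_pos (fun b _ => hK a b) ⟨z₀, mem_univ _⟩)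
      ⟨z₀, mem_univ _⟩, fun f a b => (h a b f).trans ?_⟩
    refine mul_le_mul_of_nonneg_right ?_ (hS f)
    exact (single_le_sum (f := fun b => K a b) (fun b _ => (hK a b).le) (mem_univ b)).trans
      (single_le_sum (f := fun a => ∑ b, K a b)
        (fun a _ => sum_nonneg fun b _ => (hK a b).le) (mem_univ a))
  · exact ⟨1, one_pos, fun f a => (hZ ⟨a⟩).elim⟩

theorem varWrt_le_of_sq_sub_le (hζ : IsPosProb ζ) {B : ℝ}
    (h : ∀ a b, (f a - f b) ^ 2 ≤ B) : varWrt ζ f ≤ B := by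
  obtain ⟨a⟩ : Nonempty Z := by
    by_contra hZ
    rw [not_nonempty_iff] at hZ
    simpa using hζ.2
  rw [varWrt_eq_sum_sub_sq hζ.2 f (f a)]
  calc _ ≤ ∑ z, ζ z * (f z - f a) ^ 2 := sub_le_self _ (sq_nonneg _)
    _ ≤ ∑ z, ζ z * B := sum_le_sum fun z _ => mul_le_mul_of_nonneg_left (h z a) (hζ.1 z).le
    _ = B := by rw [← sum_mul, hζ.2, one_mul]

theorem sq_sub_le_mul_fisher_term {x y C : ℝ} (hx : 0 < x) (hy : 0 < y) (hxC : x ≤ C)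
    (hyC : y ≤ C) : (x - y) ^ 2 ≤ 4 * C * (x * (y / x - 1 - Real.log (y / x))) := by
  obtain ⟨a, ha, rfl⟩ : ∃ a, 0 < a ∧ a ^ 2 = x := ⟨√x, Real.sqrt_pos.2 hx, Real.sq_sqrt hx.le⟩
  obtain ⟨b, hb, rfl⟩ : ∃ b, 0 < b ∧ b ^ 2 = y := ⟨√y, Real.sqrt_pos.2 hy, Real.sq_sqrt hy.le⟩
  have hlog : Real.log (b ^ 2 / a ^ 2) ≤ 2 * (b / a - 1) := by
    rw [← div_pow, Real.log_pow]
    push_cast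
    linarith [Real.log_le_sub_one_of_pos (div_pos hb ha)]
  have h1 : (a - b) ^ 2 ≤ a ^ 2 * (b ^ 2 / a ^ 2 - 1 - Real.log (b ^ 2 / a ^ 2)) := by
    calc (a - b) ^ 2 = a ^ 2 * (b ^ 2 / a ^ 2 - 1 - 2 * (b / a - 1)) := by field_simp; ring
      _ ≤ _ := by gcongr
  have h2 : (a + b) ^ 2 ≤ 4 * C := by nlinarith [sq_nonneg (a - b)]
  calc (a ^ 2 - b ^ 2) ^ 2 = (a + b) ^ 2 * (a - b) ^ 2 := by ring
    _ ≤ _ := mul_le_mul h2 h1 (sq_nonneg _) (by nlinarith)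

theorem IsDensity.le_inv {c : ℝ} (hc : 0 < c) (hζ : IsPosProb ζ) (hcζ : ∀ z, c ≤ ζ z)
    (hφ : IsDensity ζ φ) (z : Z) : φ z ≤ c⁻¹ := by
  have h : φ z * ζ z ≤ 1 := by
    rw [← hφ.2]
    exact single_le_sum (f := fun z => φ z * ζ z)
      (fun z _ => mul_nonneg (hφ.1 z).le (hζ.1 z).le) (mem_univ z)
  rw [← one_div, le_div_iff₀ hc]
  exact (mul_le_mul_of_nonneg_left (hcζ z) (hφ.1 z).le).trans h

theorem fisherInfo_ge {c : ℝ} (hM : IsGenerator M) (hc : 0 < c) (hζ : IsPosProb ζ)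
    (hcζ : ∀ z, c ≤ ζ z) (hφ : IsDensity ζ φ) :
    c ^ 2 / 4 * ∑ z, ∑ z', M z z' * (φ z - φ z') ^ 2 ≤ fisherInfo ζ φ M := by
  simp only [mul_sum, fisherInfo]
  refine sum_le_sum fun z _ => sum_le_sum fun z' _ => ?_
  rcases eq_or_ne z z' with rfl | hne
  · simp [div_self (hφ.1 z).ne']
  have h := sq_sub_le_mul_fisher_term (hφ.1 z) (hφ.1 z') (hφ.le_inv hc hζ hcζ z)
    (hφ.le_inv hc hζ hcζ z')
  set X := φ z * (φ z' / φ z - 1 - Real.log (φ z' / φ z)) with hX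
  have hX0 : 0 ≤ X := by
    refine mul_nonneg (hφ.1 z).le ?_
    linarith [Real.log_le_sub_one_of_pos (div_pos (hφ.1 z') (hφ.1 z))]
  calc c ^ 2 / 4 * (M z z' * (φ z - φ z') ^ 2)
      ≤ c ^ 2 / 4 * (M z z' * (4 * c⁻¹ * X)) := by
        have := hM.1 z z' hne
        gcongr
    _ = M z z' * c * X := by field_simp
    _ ≤ M z z' * ζ z * X := by
        have := hM.1 z z' hne
        have := hcζ z
        gcongr
    _ = _ := by rw [hX]; ring

theorem dirichletForm_ge {c : ℝ} (hM : IsGenerator M) (hcζ : ∀ z, c ≤ ζ z) (f : Z → ℝ) :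
    c * ∑ z, ∑ z', M z z' * (f z - f z') ^ 2 ≤ 2 * dirichletForm ζ f M := by
  rw [dirichletForm, ← mul_assoc, mul_one_div_cancel two_ne_zero, one_mul]
  simp only [mul_sum]
  refine sum_le_sum fun z _ => sum_le_sum fun z' _ => ?_
  have := mul_le_mul_of_nonneg_right (hcζ z) (hM.mul_sq_sub_nonneg f z z')
  linarith

theorem dirichletForm_nonneg (hM : IsGenerator M) (hζ : ∀ z, 0 ≤ ζ z) (f : Z → ℝ) :
    0 ≤ dirichletForm ζ f M := by
  linarith [dirichletForm_ge hM hζ f]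

theorem fisherInfo_nonneg (hM : IsGenerator M) (hζ : IsPosProb ζ) (hφ : IsDensity ζ φ) :
    0 ≤ fisherInfo ζ φ M := by
  refine sum_nonneg fun z _ => sum_nonneg fun z' _ => ?_
  rcases eq_or_ne z z' with rfl | hne
  · simp [div_self (hφ.1 z).ne']
  refine mul_nonneg (mul_nonneg (mul_nonneg (hM.1 z z' hne) (hζ.1 z).le) (hφ.1 z).le) ?_
  linarith [Real.log_le_sub_one_of_pos (div_pos (hφ.1 z') (hφ.1 z))]

/-- Modified log-Sobolev and Poincaré inequalities, uniform over measures bounded below. -/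
theorem exists_uniform_logSobolev (hM : IsGenerator M) (hirr : IsIrreducibleGen M) {c : ℝ}
    (hc : 0 < c) :
    ∃ α : ℝ, 0 < α ∧ ∀ ζ : Z → ℝ, IsPosProb ζ → (∀ z, c ≤ ζ z) →
      (∀ φ, IsDensity ζ φ → α * relEnt ζ φ ≤ fisherInfo ζ φ M) ∧
      ∀ f, α * varWrt ζ f ≤ 2 * dirichletForm ζ f M := by
  obtain ⟨K, hK, h⟩ := exists_sq_sub_le_mul_sum hM hirr
  have hd : 0 < min (c ^ 2 / 4) c := by positivity
  refine ⟨min (c ^ 2 / 4) c / K, by positivity, fun ζ hζ hcζ => ?_⟩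
  have hvar : ∀ f, min (c ^ 2 / 4) c / K * varWrt ζ f
      ≤ min (c ^ 2 / 4) c * ∑ z, ∑ z', M z z' * (f z - f z') ^ 2 := fun f => by
    rw [div_mul_eq_mul_div, div_le_iff₀ hK, mul_assoc, mul_comm _ K]
    exact mul_le_mul_of_nonneg_left (varWrt_le_of_sq_sub_le hζ (h f)) hd.le
  have hS : ∀ f : Z → ℝ, 0 ≤ ∑ z, ∑ z', M z z' * (f z - f z') ^ 2 := fun f =>
    sum_nonneg fun z _ => sum_nonneg fun z' _ => hM.mul_sq_sub_nonneg f z z'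
  refine ⟨fun φ hφ => ?_, fun f => ?_⟩
  · calc _ ≤ min (c ^ 2 / 4) c / K * varWrt ζ φ :=
        mul_le_mul_of_nonneg_left (relEnt_le_varWrt hζ hφ) (by positivity)
      _ ≤ _ := hvar φ
      _ ≤ _ := mul_le_mul_of_nonneg_right (min_le_left _ _) (hS φ)
      _ ≤ _ := fisherInfo_ge hM hc hζ hcζ hφ
  · exact (hvar f).trans ((mul_le_mul_of_nonneg_right (min_le_right _ _) (hS f)).trans
      (dirichletForm_ge hM hcζ f))

theorem exists_isDensity_ne_one (hcard : 2 ≤ Fintype.card Z) (hζ : IsPosProb ζ) :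
    ∃ φ, IsDensity ζ φ ∧ φ ≠ fun _ => 1 := by
  classical
  obtain ⟨a, b, hab⟩ := Fintype.one_lt_card_iff.1 hcard
  refine ⟨fun z => 1 / 2 + if z = a then 1 / 2 / ζ a else 0, ⟨fun z => ?_, ?_⟩, fun h => ?_⟩
  · have := hζ.1 a
    dsimp only
    split_ifs <;> positivity
  · have := (hζ.1 a).ne'
    simp only [expec, add_mul, sum_add_distrib, ← mul_sum, hζ.2, ite_mul, zero_mul,
      sum_ite_eq', mem_univ, if_true]
    field_simp
    norm_num
  · have := congrFun h b
    simp only [hab.symm, if_false] at this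
    norm_num at this

theorem le_gLSI (hcard : 2 ≤ Fintype.card Z) (hζ : IsPosProb ζ) {α : ℝ}
    (h : ∀ φ, IsDensity ζ φ → α * relEnt ζ φ ≤ fisherInfo ζ φ M) : α ≤ gLSI ζ M := by
  obtain ⟨φ, hφ, hne⟩ := exists_isDensity_ne_one hcard hζ
  refine le_csInf ⟨_, φ, hφ, hne, rfl⟩ ?_
  rintro _ ⟨φ, hφ, hne, rfl⟩
  exact (le_div_iff₀ (relEnt_pos hζ hφ hne)).2 (h φ hφ)

theorem gLSI_mul_relEnt_le (hM : IsGenerator M) (hζ : IsPosProb ζ) (hφ : IsDensity ζ φ)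
    (hne : φ ≠ fun _ => 1) : gLSI ζ M * relEnt ζ φ ≤ fisherInfo ζ φ M := by
  rw [← le_div_iff₀ (relEnt_pos hζ hφ hne)]
  refine csInf_le ⟨0, ?_⟩ ⟨φ, hφ, hne, rfl⟩
  rintro _ ⟨φ, hφ, hne, rfl⟩
  exact div_nonneg (fisherInfo_nonneg hM hζ hφ) (relEnt_pos hζ hφ hne).le

open Topology

theorem tendsto_log_one_add_mul_sub_div_sq (a : ℝ) :
    Tendsto (fun ε : ℝ => (Real.log (1 + ε * a) - ε * a) / ε ^ 2) (𝓝[>] 0)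
      (𝓝 (-(a ^ 2 / 2))) := by
  rw [tendsto_iff_norm_sub_tendsto_zero]
  have hlim : Tendsto (fun ε : ℝ => 2 * |ε| * |a| ^ 3) (𝓝[>] 0) (𝓝 0) := by
    have : Continuous fun ε : ℝ => 2 * |ε| * |a| ^ 3 := by fun_prop
    simpa using (this.tendsto 0).mono_left nhdsWithin_le_nhds
  have hsmall : ∀ᶠ ε : ℝ in 𝓝[>] 0, |ε * a| < 1 / 2 := by
    have : Continuous fun ε : ℝ => |ε * a| := by fun_prop
    refine ((this.tendsto 0).mono_left nhdsWithin_le_nhds).eventually_lt_const ?_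
    simp
  refine squeeze_zero' (Eventually.of_forall fun _ => norm_nonneg _) ?_ hlim
  filter_upwards [hsmall, self_mem_nhdsWithin] with ε hε (hε0 : 0 < ε)
  have hlog := Real.abs_log_sub_add_sum_range_le (x := -(ε * a)) (by rw [abs_neg]; linarith) 2
  rw [abs_neg, sub_neg_eq_add] at hlog
  simp only [sum_range_succ, sum_range_zero] at hlog
  have h1 : (Real.log (1 + ε * a) - ε * a) / ε ^ 2 - -(a ^ 2 / 2)
      = (Real.log (1 + ε * a) - ε * a + (ε * a) ^ 2 / 2) / ε ^ 2 := by
    field_simp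
    ring
  rw [h1, Real.norm_eq_abs, abs_div, abs_of_pos (pow_pos hε0 2), div_le_iff₀ (pow_pos hε0 2)]
  have h2 : |ε * a| ^ (2 + 1) / (1 - |ε * a|) ≤ 2 * |ε * a| ^ 3 := by
    have hx := abs_nonneg (ε * a)
    generalize |ε * a| = x at hx hε
    rw [div_le_iff₀ (by linarith)]
    have h3 := mul_nonneg (pow_nonneg hx 3) (sub_nonneg.2 hε.le)
    norm_num only
    linarith
  have h3 : 2 * |ε * a| ^ 3 = 2 * |ε| * |a| ^ 3 * ε ^ 2 := by
    rw [abs_mul, ← sq_abs ε]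
    ring
  rw [← h3]
  refine le_trans (le_of_eq ?_) (hlog.trans h2)
  congr 1
  push_cast
  ring

theorem gLSI_le_two_mul_gPI (hcard : 2 ≤ Fintype.card Z) (hM : IsGenerator M)
    (hζ : IsPosProb ζ) : gLSI ζ M ≤ 2 * gPI ζ M := by
  rw [← div_le_iff₀' two_pos]
  refine le_csInf ?_ ?_
  · obtain ⟨a, b, hab⟩ := Fintype.one_lt_card_iff.1 hcard
    classical
    exact ⟨_, fun z => if z = a then 1 else 0, ⟨a, b, by simp [hab.symm]⟩, rfl⟩
  rintro _ ⟨f, hf, rfl⟩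
  rw [le_div_iff₀ (varWrt_pos hζ hf)]
  set g : Z → ℝ := fun z => f z - expec ζ f with hg
  have hg0 : ∑ z, g z * ζ z = 0 := by
    simp only [hg, sub_mul, sum_sub_distrib, ← mul_sum, hζ.2, mul_one]
    exact sub_self _
  set L : ℝ → Z → ℝ := fun ε z => (Real.log (1 + ε * g z) - ε * g z) / ε ^ 2 with hL
  have hLlim : ∀ z, Tendsto (fun ε => L ε z) (𝓝[>] 0) (𝓝 (-(g z ^ 2 / 2))) := fun z =>
    tendsto_log_one_add_mul_sub_div_sq (g z)
  have hone : ∀ z, Tendsto (fun ε : ℝ => 1 + ε * g z) (𝓝[>] 0) (𝓝 1) := fun z => by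
    have : Continuous fun ε : ℝ => 1 + ε * g z := by fun_prop
    simpa using (this.tendsto 0).mono_left nhdsWithin_le_nhds
  have hH : Tendsto (fun ε => ∑ z, (g z ^ 2 + (1 + ε * g z) * L ε z) * ζ z) (𝓝[>] 0)
      (𝓝 (varWrt ζ f / 2)) := by
    have : varWrt ζ f / 2 = ∑ z, (g z ^ 2 + 1 * -(g z ^ 2 / 2)) * ζ z := by
      rw [varWrt_eq_sum_sub_sq hζ.2 f (expec ζ f), sub_self, zero_pow two_ne_zero, sub_zero,
        sum_div]
      exact sum_congr rfl fun z _ => by simp only [hg]; ring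
    rw [this]
    exact tendsto_finsetSum _ fun z _ =>
      (tendsto_const_nhds.add ((hone z).mul (hLlim z))).mul_const _
  have hR : Tendsto (fun ε => ∑ z, ∑ z', M z z' * ζ z *
      (g z * (g z - g z') + (1 + ε * g z) * (L ε z - L ε z'))) (𝓝[>] 0)
      (𝓝 (dirichletForm ζ f M)) := by
    have : dirichletForm ζ f M = ∑ z, ∑ z', M z z' * ζ z *
        (g z * (g z - g z') + 1 * (-(g z ^ 2 / 2) - -(g z' ^ 2 / 2))) := by
      simp only [dirichletForm, mul_sum]
      exact sum_congr rfl fun z _ => sum_congr rfl fun z' _ => by simp only [hg]; ring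
    rw [this]
    exact tendsto_finsetSum _ fun z _ => tendsto_finsetSum _ fun z' _ =>
      (tendsto_const_nhds.add ((hone z).mul ((hLlim z).sub (hLlim z')))).const_mul _
  have hle : ∀ᶠ ε : ℝ in 𝓝[>] 0,
      gLSI ζ M * ∑ z, (g z ^ 2 + (1 + ε * g z) * L ε z) * ζ z ≤
        ∑ z, ∑ z', M z z' * ζ z *
          (g z * (g z - g z') + (1 + ε * g z) * (L ε z - L ε z')) := by
    have hpos : ∀ᶠ ε : ℝ in 𝓝[>] 0, ∀ z, 0 < 1 + ε * g z :=
      eventually_all.2 fun z => (hone z).eventually_const_lt one_pos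
    filter_upwards [hpos, self_mem_nhdsWithin] with ε hp (hε : 0 < ε)
    have hlog : ∀ z, Real.log (1 + ε * g z) = ε * g z + ε ^ 2 * L ε z := fun z => by
      simp only [hL]
      field_simp
      ring
    have hd : IsDensity ζ fun z => 1 + ε * g z := by
      refine ⟨hp, ?_⟩
      simp only [expec, add_mul, one_mul, sum_add_distrib, mul_assoc, ← mul_sum, hg0, hζ.2,
        mul_zero, add_zero]
    have hne : (fun z => 1 + ε * g z) ≠ fun _ => 1 := fun h => by
      obtain ⟨a, b, hab⟩ := hf
      have h0 : ∀ z, f z = expec ζ f := fun z => by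
        have := congrFun h z
        simp only [add_eq_left, mul_eq_zero, hε.ne', false_or, hg] at this
        linarith
      exact hab ((h0 a).trans (h0 b).symm)
    have hmain := gLSI_mul_relEnt_le hM hζ hd hne
    have hent : relEnt ζ (fun z => 1 + ε * g z)
        = ε ^ 2 * ∑ z, (g z ^ 2 + (1 + ε * g z) * L ε z) * ζ z := by
      have : relEnt ζ (fun z => 1 + ε * g z)
          = ε * ∑ z, g z * ζ z + ε ^ 2 * ∑ z, (g z ^ 2 + (1 + ε * g z) * L ε z) * ζ z := by
        simp only [relEnt, mul_sum, ← sum_add_distrib, hlog]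
        exact sum_congr rfl fun z _ => by ring
      rw [this, hg0, mul_zero, zero_add]
    have hfis : fisherInfo ζ (fun z => 1 + ε * g z) M
        = ε ^ 2 * ∑ z, ∑ z', M z z' * ζ z *
          (g z * (g z - g z') + (1 + ε * g z) * (L ε z - L ε z')) := by
      simp only [fisherInfo, mul_sum]
      refine sum_congr rfl fun z _ => sum_congr rfl fun z' _ => ?_
      rw [Real.log_div (hp z').ne' (hp z).ne', hlog, hlog]
      have := (hp z).ne'
      field_simp
      ring
    rw [hent, hfis, mul_left_comm] at hmain
    exact le_of_mul_le_mul_left hmain (pow_pos hε 2)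
  have := le_of_tendsto_of_tendsto (hH.const_mul _) hR hle
  linarith

end FunctionalInequalities

/-- `u` solves the forward Kolmogorov equation on `[0, ∞)`. -/
def IsForwardSolution {Z : Type*} [Fintype Z] (M : Z → Z → ℝ) (u : ℝ → Z → ℝ) : Prop :=
  ∀ t ∈ Set.Ici (0 : ℝ), ∀ z : Z,
    HasDerivWithinAt (fun s => u s z) (∑ z' : Z, M z' z * u t z') (Set.Ici (0 : ℝ)) t

/-- The operator `Mᵀ + Λ`, which is entrywise nonnegative for large `Λ`. -/
noncomputable def shiftedForward {Z : Type*} [Fintype Z] (M : Z → Z → ℝ) (Λ : ℝ) :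
    (Z → ℝ) →L[ℝ] (Z → ℝ) :=
  ContinuousLinearMap.pi (fun z => ∑ z', M z' z • ContinuousLinearMap.proj z') + Λ • 1

section ForwardEquation

variable {Z : Type*} [Fintype Z] {M : Z → Z → ℝ} {u : ℝ → Z → ℝ} {t : ℝ}

theorem shiftedForward_apply (M : Z → Z → ℝ) (Λ : ℝ) (f : Z → ℝ) (z : Z) :
    shiftedForward M Λ f z = ∑ z', M z' z * f z' + Λ * f z := by
  simp [shiftedForward]

theorem IsForwardSolution.continuousOn (hu : IsForwardSolution M u) (z : Z) :
    ContinuousOn (fun t => u t z) (Set.Ici 0) :=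
  fun t ht => (hu t ht z).continuousWithinAt

theorem IsForwardSolution.hasDerivAt (hu : IsForwardSolution M u) (ht : 0 < t) (z : Z) :
    HasDerivAt (fun s => u s z) (∑ z', M z' z * u t z') t :=
  (hu t ht.le z).hasDerivAt (Ici_mem_nhds ht)

theorem IsForwardSolution.shift (hu : IsForwardSolution M u) {s : ℝ} (hs : 0 ≤ s) :
    IsForwardSolution M fun r => u (s + r) := by
  intro t ht z
  have hadd : HasDerivWithinAt (fun r : ℝ => s + r) 1 (Set.Ici 0) t :=
    ((hasDerivAt_id t).const_add s).hasDerivWithinAt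
  have := (hu (s + t) (add_nonneg hs ht) z).scomp t hadd fun r hr => add_nonneg hs hr
  rwa [one_smul] at this

theorem IsForwardSolution.sum_eq (hu : IsForwardSolution M u) (hM : IsGenerator M)
    (ht : 0 ≤ t) : ∑ z, u t z = ∑ z, u 0 z := by
  have hd : ∀ s ∈ Set.Ici (0 : ℝ), HasDerivWithinAt (fun s => ∑ z, u s z) 0 (Set.Ici 0) s := by
    intro s hs
    have h := HasDerivWithinAt.fun_sum (u := univ) fun z _ => hu s hs z
    rwa [sum_comm, sum_congr rfl fun z' _ => (sum_mul univ (fun z => M z' z) (u s z')).symm,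
      sum_congr rfl fun z' _ => by rw [hM.2 z', zero_mul], sum_const_zero] at h
  exact constant_of_has_deriv_right_zero
    (fun s hs => ((hd s hs.1).continuousWithinAt).mono Set.Icc_subset_Ici_self)
    (fun s hs => (hd s hs.1).mono (Set.Ici_subset_Ici.2 hs.1)) t ⟨ht, le_rfl⟩

theorem IsForwardSolution.eq_exp (hu : IsForwardSolution M u) (Λ : ℝ) (ht : 0 ≤ t) :
    u t = Real.exp (-(Λ * t)) • NormedSpace.exp (t • shiftedForward M Λ) (u 0) := by
  set B := shiftedForward M Λ with hB
  have hd : ∀ s ∈ Set.Ici (0 : ℝ), HasDerivWithinAt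
      (fun s => Real.exp (Λ * s) • NormedSpace.exp ((t - s) • B) (u s)) 0 (Set.Ici 0) s := by
    intro s hs
    have hus : HasDerivWithinAt u (B (u s) - Λ • u s) (Set.Ici 0) s := by
      refine hasDerivWithinAt_pi.2 fun z => ?_
      refine (hu s hs z).congr_deriv ?_
      simp [hB, shiftedForward_apply]
    have hexp : HasDerivAt (fun s => NormedSpace.exp ((t - s) • B))
        (-(NormedSpace.exp ((t - s) • B) * B)) s := by
      have h := (hasDerivAt_exp_smul_const (𝕂 := ℝ) B (t - s)).scomp s
        ((hasDerivAt_id s).const_sub t)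
      rwa [neg_smul, one_smul] at h
    have hscal : HasDerivAt (fun s => Real.exp (Λ * s)) (Real.exp (Λ * s) * Λ) s := by
      simpa using ((hasDerivAt_id s).const_mul Λ).exp
    have h := hscal.hasDerivWithinAt.fun_smul (hexp.hasDerivWithinAt.clm_apply hus)
    refine h.congr_deriv ?_
    simp only [neg_apply, mul_apply_eq_comp, map_sub, map_smul]
    module
  have hconst := constant_of_has_deriv_right_zero
    (fun s hs => ((hd s hs.1).continuousWithinAt).mono Set.Icc_subset_Ici_self)
    (fun s hs => (hd s hs.1).mono (Set.Ici_subset_Ici.2 hs.1)) t ⟨ht, le_rfl⟩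
  simp only [sub_self, zero_smul, NormedSpace.exp_zero, one_apply_eq_self, mul_zero,
    Real.exp_zero, one_smul, sub_zero] at hconst
  rw [← hconst, smul_smul, ← Real.exp_add, neg_add_cancel, Real.exp_zero, one_smul]

theorem mul_le_shiftedForward (hM : IsGenerator M) {Λ : ℝ} (hΛ : ∀ z, |M z z| ≤ Λ) {f : Z → ℝ}
    (hf : 0 ≤ f) (a b : Z) : M a b * f a ≤ shiftedForward M Λ f b := by
  classical
  have h : shiftedForward M Λ f b = ∑ z, (M z b + if z = b then Λ else 0) * f z := by
    simp [shiftedForward_apply, add_mul, sum_add_distrib]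
  have hΛ0 : ∀ z, 0 ≤ if z = b then Λ else 0 := fun z => by
    split_ifs
    exacts [(abs_nonneg _).trans (hΛ b), le_rfl]
  rw [h]
  refine le_trans ?_ (single_le_sum (f := fun z => (M z b + if z = b then Λ else 0) * f z)
    (fun z _ => mul_nonneg ?_ (hf z)) (mem_univ a))
  · exact mul_le_mul_of_nonneg_right (le_add_of_nonneg_right (hΛ0 a)) (hf a)
  · split_ifs with hz
    · subst hz
      linarith [neg_abs_le (M z z), hΛ z]
    · linarith [hM.1 z b hz]

theorem shiftedForward_nonneg (hM : IsGenerator M) {Λ : ℝ} (hΛ : ∀ z, |M z z| ≤ Λ) {f : Z → ℝ}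
    (hf : 0 ≤ f) : 0 ≤ shiftedForward M Λ f := by
  intro b
  have h := mul_le_shiftedForward hM hΛ hf
  by_cases hb : ∃ a, a ≠ b
  · obtain ⟨a, ha⟩ := hb
    exact (mul_nonneg (hM.1 a b ha) (hf a)).trans (h a b)
  · push Not at hb
    have : M b b = 0 := by
      rw [← hM.2 b, Fintype.sum_eq_single b fun z hz => (hz (hb z)).elim]
    simpa [this] using h b b

theorem pow_shiftedForward_nonneg (hM : IsGenerator M) {Λ : ℝ} (hΛ : ∀ z, |M z z| ≤ Λ)
    {f : Z → ℝ} (hf : 0 ≤ f) (n : ℕ) : 0 ≤ (shiftedForward M Λ ^ n) f := by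
  induction n with
  | zero => exact hf
  | succ n ih =>
    rw [pow_succ', mul_apply_eq_comp]
    exact shiftedForward_nonneg hM hΛ ih

theorem exists_mul_le_pow_shiftedForward (hM : IsGenerator M) (hirr : IsIrreducibleGen M)
    {Λ : ℝ} (hΛ : ∀ z, |M z z| ≤ Λ) (a b : Z) :
    ∃ (n : ℕ) (k : ℝ), 0 < k ∧ ∀ f : Z → ℝ, 0 ≤ f → k * f a ≤ (shiftedForward M Λ ^ n) f b := by
  induction hirr.reflTransGen a b with
  | refl => exact ⟨0, 1, one_pos, fun f _ => by simp⟩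
  | @tail b c _ hbc ih =>
    obtain ⟨n, k, hk, h⟩ := ih
    refine ⟨n + 1, M b c * k, mul_pos hbc hk, fun f hf => ?_⟩
    rw [pow_succ', mul_apply_eq_comp, mul_assoc]
    exact (mul_le_mul_of_nonneg_left (h f hf) hbc.le).trans
      (mul_le_shiftedForward hM hΛ (pow_shiftedForward_nonneg hM hΛ hf n) b c)

theorem hasSum_exp_shiftedForward (Λ t : ℝ) (f : Z → ℝ) (z : Z) :
    HasSum (fun n : ℕ => (n.factorial : ℝ)⁻¹ * (t ^ n * (shiftedForward M Λ ^ n) f z))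
      (NormedSpace.exp (t • shiftedForward M Λ) f z) := by
  have h := NormedSpace.exp_series_hasSum_exp' (𝕂 := ℝ) (t • shiftedForward M Λ)
  have h2 := ((ContinuousLinearMap.proj (R := ℝ) (φ := fun _ : Z => ℝ) z).comp
    (ContinuousLinearMap.apply ℝ (Z → ℝ) f)).hasSum h
  simpa [Function.comp_def, smul_pow] using h2

theorem le_exp_shiftedForward (hM : IsGenerator M) {Λ : ℝ} (hΛ : ∀ z, |M z z| ≤ Λ)
    (ht : 0 ≤ t) {f : Z → ℝ} (hf : 0 ≤ f) (n : ℕ) (z : Z) :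
    (n.factorial : ℝ)⁻¹ * (t ^ n * (shiftedForward M Λ ^ n) f z) ≤
      NormedSpace.exp (t • shiftedForward M Λ) f z :=
  le_hasSum (hasSum_exp_shiftedForward Λ t f z) n fun m _ =>
    mul_nonneg (by positivity)
      (mul_nonneg (by positivity) (pow_shiftedForward_nonneg hM hΛ hf m z))

theorem abs_diag_le_sum (M : Z → Z → ℝ) (z : Z) : |M z z| ≤ ∑ z, |M z z| :=
  single_le_sum (f := fun z => |M z z|) (fun _ _ => abs_nonneg _) (mem_univ z)

theorem IsForwardSolution.isProb (hu : IsForwardSolution M u) (hM : IsGenerator M)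
    (h0 : IsProb (u 0)) (ht : 0 ≤ t) : IsProb (u t) := by
  refine ⟨fun z => ?_, (hu.sum_eq hM ht).trans h0.2⟩
  have h := le_exp_shiftedForward hM (abs_diag_le_sum M) ht (f := u 0) h0.1 0 z
  rw [hu.eq_exp (∑ z, |M z z|) ht]
  refine mul_nonneg (Real.exp_pos _).le (le_trans ?_ h)
  simpa using h0.1 z

theorem exists_forall_le_isForwardSolution (hM : IsGenerator M) (hirr : IsIrreducibleGen M)
    (ht : 0 < t) : ∃ c : ℝ, 0 < c ∧ ∀ u, IsForwardSolution M u → IsProb (u 0) →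
      ∀ z, c ≤ u t z := by
  set Λ := ∑ z, |M z z|
  have hΛ : ∀ z, |M z z| ≤ Λ := abs_diag_le_sum M
  choose n k hk h using exists_mul_le_pow_shiftedForward hM hirr hΛ
  by_cases hZ : Nonempty Z
  swap
  · exact ⟨1, one_pos, fun u _ _ z => (hZ ⟨z⟩).elim⟩
  obtain ⟨p, hp⟩ := Finite.exists_min fun p : Z × Z =>
    ((n p.1 p.2).factorial : ℝ)⁻¹ * (t ^ n p.1 p.2 * k p.1 p.2)
  set c := ((n p.1 p.2).factorial : ℝ)⁻¹ * (t ^ n p.1 p.2 * k p.1 p.2)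
  have hc : 0 < c := by
    have := hk p.1 p.2
    positivity
  have hcardpos : (0 : ℝ) < Fintype.card Z := by exact_mod_cast Fintype.card_pos
  refine ⟨Real.exp (-(Λ * t)) * (c / Fintype.card Z), by positivity, fun u hu h0 z => ?_⟩
  rw [hu.eq_exp Λ ht.le]
  refine mul_le_mul_of_nonneg_left ?_ (Real.exp_pos _).le
  set v := NormedSpace.exp (t • shiftedForward M Λ) (u 0) z
  have hv : ∀ a, c * u 0 a ≤ v := fun a => by
    refine le_trans ?_ (le_exp_shiftedForward hM hΛ ht.le h0.1 (n a z) z)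
    refine (mul_le_mul_of_nonneg_right (hp (a, z)) (h0.1 a)).trans ?_
    rw [mul_assoc, mul_assoc]
    have := h a z (u 0) h0.1
    gcongr
  rw [div_le_iff₀ hcardpos]
  calc c = ∑ a, c * u 0 a := by rw [← mul_sum, h0.2, mul_one]
    _ ≤ ∑ _a : Z, v := sum_le_sum fun a _ => hv a
    _ = v * Fintype.card Z := by simp [mul_comm]

theorem IsForwardSolution.isPosProb (hu : IsForwardSolution M u) (hM : IsGenerator M)
    (hirr : IsIrreducibleGen M) (h0 : IsProb (u 0)) (ht : 0 < t) : IsPosProb (u t) := by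
  obtain ⟨c, hc, h⟩ := exists_forall_le_isForwardSolution hM hirr ht
  exact ⟨fun z => hc.trans_le (h u hu h0 z), (hu.isProb hM h0 ht.le).2⟩

end ForwardEquation

section Decay

variable {Z : Type*} [Fintype Z] {M : Z → Z → ℝ} {μ ζ : ℝ → Z → ℝ} {t : ℝ}

theorem expec_div (m w : Z → ℝ) (hw : ∀ z, 0 < w z) : expec w (fun z => m z / w z) = ∑ z, m z :=
  sum_congr rfl fun z _ => div_mul_cancel₀ _ (hw z).ne'

theorem isDensity_div {m w : Z → ℝ} (hm : IsPosProb m) (hw : IsPosProb w) :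
    IsDensity w fun z => m z / w z :=
  ⟨fun z => div_pos (hm.1 z) (hw.1 z), (expec_div m w hw.1).trans hm.2⟩

theorem sum_forward_mul (hM : IsGenerator M) (w g : Z → ℝ) (F : Z → Z → ℝ) :
    ∑ z, ∑ z', M z' z * w z' * F z' z
      = ∑ z, ∑ z', M z z' * w z * (F z z' - g z) := by
  have h : ∑ z, ∑ z', M z z' * w z * g z = 0 := sum_eq_zero fun z _ => by
    rw [← sum_mul, ← sum_mul, hM.2 z, zero_mul, zero_mul]
  rw [sum_comm, ← sub_zero (∑ z, _), ← h]
  simp only [← sum_sub_distrib, mul_sub]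

theorem hasDerivAt_varWrt_div (hM : IsGenerator M) (hμ : IsForwardSolution M μ)
    (hζ : IsForwardSolution M ζ) (hμ0 : IsProb (μ 0)) (ht : 0 < t)
    (hζpos : ∀ s, 0 < s → ∀ z, 0 < ζ s z) :
    HasDerivAt (fun s => varWrt (ζ s) fun z => μ s z / ζ s z)
      (-2 * dirichletForm (ζ t) (fun z => μ t z / ζ t z) M) t := by
  have hd : HasDerivAt (fun s => ∑ z, (μ s z / ζ s z) ^ 2 * ζ s z - 1)
      (∑ z, (2 * (μ t z / ζ t z) * (∑ z', M z' z * μ t z') -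
        (μ t z / ζ t z) ^ 2 * ∑ z', M z' z * ζ t z')) t := by
    refine (HasDerivAt.fun_sum fun z _ => ?_).sub_const 1
    have hne := (hζpos t ht z).ne'
    have h := (((hμ.hasDerivAt ht z).fun_div (hζ.hasDerivAt ht z) hne).fun_pow 2).fun_mul
      (hζ.hasDerivAt ht z)
    refine h.congr_deriv ?_
    generalize ∑ z', M z' z * μ t z' = A
    generalize ∑ z', M z' z * ζ t z' = B
    simp only [Nat.cast_ofNat, Nat.add_one_sub_one, pow_one]
    field_simp
    ring
  have heq : (fun s => varWrt (ζ s) fun z => μ s z / ζ s z) =ᶠ[nhds t]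
      fun s => ∑ z, (μ s z / ζ s z) ^ 2 * ζ s z - 1 := by
    filter_upwards [Ioi_mem_nhds ht] with s hs
    rw [varWrt, expec_div _ _ (hζpos s hs), hμ.sum_eq hM (le_of_lt hs), hμ0.2, one_pow]
    rfl
  refine (hd.congr_of_eventuallyEq heq).congr_deriv (Eq.symm ?_)
  set φ : Z → ℝ := fun z => μ t z / ζ t z with hφ
  have hμφ : ∀ z, μ t z = ζ t z * φ z := fun z => by
    rw [hφ, mul_div_cancel₀ _ (hζpos t ht z).ne']
  calc -2 * dirichletForm (ζ t) φ M
      = ∑ z, ∑ z', M z z' * ζ t z * ((2 * φ z' * φ z - φ z' ^ 2) - φ z ^ 2) := by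
        simp only [dirichletForm, mul_sum]
        exact sum_congr rfl fun z _ => sum_congr rfl fun z' _ => by ring
    _ = ∑ z, ∑ z', M z' z * ζ t z' * (2 * φ z * φ z' - φ z ^ 2) :=
        (sum_forward_mul hM _ _ fun a b => 2 * φ b * φ a - φ b ^ 2).symm
    _ = _ := by
        simp only [mul_sum, ← sum_sub_distrib]
        refine sum_congr rfl fun z _ => sum_congr rfl fun z' _ => ?_
        rw [hμφ z']
        simp only [hφ]
        ring

theorem hasDerivAt_relEnt_div (hM : IsGenerator M) (hμ : IsForwardSolution M μ)
    (hζ : IsForwardSolution M ζ) (ht : 0 < t) (hμpos : ∀ z, 0 < μ t z)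
    (hζpos : ∀ s, 0 < s → ∀ z, 0 < ζ s z) :
    HasDerivAt (fun s => relEnt (ζ s) fun z => μ s z / ζ s z)
      (-fisherInfo (ζ t) (fun z => μ t z / ζ t z) M) t := by
  have hd : HasDerivAt (fun s => ∑ z, μ s z * Real.log (μ s z / ζ s z))
      (∑ z, ((∑ z', M z' z * μ t z') * (Real.log (μ t z / ζ t z) + 1) -
        μ t z / ζ t z * ∑ z', M z' z * ζ t z')) t := by
    refine HasDerivAt.fun_sum fun z _ => ?_
    have hne := (hζpos t ht z).ne'
    have hne' := (hμpos z).ne'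
    have h := (hμ.hasDerivAt ht z).fun_mul
      (((hμ.hasDerivAt ht z).fun_div (hζ.hasDerivAt ht z) hne).log (div_ne_zero hne' hne))
    refine h.congr_deriv ?_
    field_simp
    ring
  have heq : (fun s => relEnt (ζ s) fun z => μ s z / ζ s z) =ᶠ[nhds t]
      fun s => ∑ z, μ s z * Real.log (μ s z / ζ s z) := by
    filter_upwards [Ioi_mem_nhds ht] with s hs
    refine sum_congr rfl fun z _ => ?_
    rw [mul_right_comm, div_mul_cancel₀ _ (hζpos s hs z).ne']
  refine (hd.congr_of_eventuallyEq heq).congr_deriv (Eq.symm ?_)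
  set φ : Z → ℝ := fun z => μ t z / ζ t z with hφ
  have hφpos : ∀ z, 0 < φ z := fun z => div_pos (hμpos z) (hζpos t ht z)
  have hμφ : ∀ z, μ t z = ζ t z * φ z := fun z => by
    rw [hφ, mul_div_cancel₀ _ (hζpos t ht z).ne']
  calc -fisherInfo (ζ t) φ M
      = ∑ z, ∑ z', M z z' * ζ t z *
          ((φ z * (Real.log (φ z') + 1) - φ z') - φ z * Real.log (φ z)) := by
        simp only [fisherInfo, ← sum_neg_distrib]
        refine sum_congr rfl fun z _ => sum_congr rfl fun z' _ => ?_
        have := (hφpos z).ne'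
        rw [Real.log_div (hφpos z').ne' this]
        field_simp
        ring
    _ = ∑ z, ∑ z', M z' z * ζ t z' * (φ z' * (Real.log (φ z) + 1) - φ z) :=
        (sum_forward_mul hM _ (fun a => φ a * Real.log (φ a))
          fun a b => φ a * (Real.log (φ b) + 1) - φ b).symm
    _ = _ := by
        simp only [mul_sum, sum_mul, ← sum_sub_distrib]
        refine sum_congr rfl fun z _ => sum_congr rfl fun z' _ => ?_
        rw [hμφ z']
        simp only [hφ]
        ring

/-- Grönwall's inequality for a functional that is nonincreasing, and decays at rate `α` after
time `δ`. -/
theorem le_mul_min_one_exp {F F' : ℝ → ℝ} {α δ : ℝ} (hα : 0 ≤ α) (hδ : 0 < δ)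
    (hcont : ContinuousOn F (Set.Ici 0)) (hderiv : ∀ t, 0 < t → HasDerivAt F (F' t) t)
    (hneg : ∀ t, 0 < t → F' t ≤ 0) (hdecay : ∀ t, δ ≤ t → F' t ≤ -α * F t) (h0 : 0 ≤ F 0)
    (ht : 0 ≤ t) : F t ≤ F 0 * min 1 (Real.exp (-α * (t - δ))) := by
  have hanti : AntitoneOn F (Set.Ici 0) := by
    refine antitoneOn_of_deriv_nonpos (convex_Ici 0) hcont ?_ ?_ <;>
      (rw [interior_Ici]; intro s hs)
    · exact (hderiv s hs).differentiableAt.differentiableWithinAt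
    · rw [(hderiv s hs).deriv]
      exact hneg s hs
  rw [mul_min_of_nonneg _ _ h0, mul_one]
  refine le_min (hanti Set.self_mem_Ici ht ht) ?_
  rcases le_total t δ with htδ | htδ
  · refine (hanti Set.self_mem_Ici ht ht).trans (le_mul_of_one_le_right h0 ?_)
    exact Real.one_le_exp (by nlinarith)
  · have hd : ∀ s ∈ Set.Ici δ, HasDerivAt (fun s => Real.exp (α * s) * F s)
        (Real.exp (α * s) * (α * F s + F' s)) s := by
      intro s hs
      have hexp : HasDerivAt (fun s => Real.exp (α * s)) (Real.exp (α * s) * α) s := by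
        simpa using ((hasDerivAt_id s).const_mul α).exp
      refine (hexp.fun_mul (hderiv s (hδ.trans_le hs))).congr_deriv ?_
      ring
    have hanti' : AntitoneOn (fun s => Real.exp (α * s) * F s) (Set.Ici δ) := by
      refine antitoneOn_of_deriv_nonpos (convex_Ici δ)
        (fun s hs => (hd s hs).continuousAt.continuousWithinAt) ?_ ?_ <;>
        (intro s hs; replace hs := interior_subset hs)
      · exact (hd s hs).differentiableAt.differentiableWithinAt
      · rw [(hd s hs).deriv]
        exact mul_nonpos_of_nonneg_of_nonpos (Real.exp_pos _).le (by linarith [hdecay s hs])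
    have h1 : Real.exp (α * t) * F t ≤ Real.exp (α * δ) * F δ :=
      hanti' Set.self_mem_Ici htδ htδ
    have h2 : F δ ≤ F 0 := hanti Set.self_mem_Ici hδ.le hδ.le
    calc F t = Real.exp (-(α * t)) * (Real.exp (α * t) * F t) := by
          rw [← mul_assoc, ← Real.exp_add, neg_add_cancel, Real.exp_zero, one_mul]
      _ ≤ Real.exp (-(α * t)) * (Real.exp (α * δ) * F 0) := by
          exact mul_le_mul_of_nonneg_left
            (h1.trans (mul_le_mul_of_nonneg_left h2 (Real.exp_pos _).le)) (Real.exp_pos _).le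
      _ = F 0 * Real.exp (-α * (t - δ)) := by
          rw [← mul_assoc, ← Real.exp_add, mul_comm]
          congr 2
          ring

end Decay

section Comparison

variable {Z : Type*} [Fintype Z] {M : Z → Z → ℝ} {μ ζ : ℝ → Z → ℝ}

theorem continuousOn_varWrt_div (hμ : IsForwardSolution M μ) (hζ : IsForwardSolution M ζ)
    (hpos : ∀ t, 0 ≤ t → ∀ z, 0 < ζ t z) :
    ContinuousOn (fun t => varWrt (ζ t) fun z => μ t z / ζ t z) (Set.Ici 0) := by
  have hc := fun z => (hμ.continuousOn z).div (hζ.continuousOn z) fun t ht => (hpos t ht z).ne'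
  exact (continuousOn_finsetSum _ fun z _ => ((hc z).pow 2).mul (hζ.continuousOn z)).sub
    ((continuousOn_finsetSum _ fun z _ => (hc z).mul (hζ.continuousOn z)).pow 2)

theorem continuousOn_relEnt_div (hμ : IsForwardSolution M μ) (hζ : IsForwardSolution M ζ)
    (hpos : ∀ t, 0 ≤ t → ∀ z, 0 < ζ t z) :
    ContinuousOn (fun t => relEnt (ζ t) fun z => μ t z / ζ t z) (Set.Ici 0) := by
  have hc := fun z => (hμ.continuousOn z).div (hζ.continuousOn z) fun t ht => (hpos t ht z).ne'
  exact continuousOn_finsetSum _ fun z _ =>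
    (Real.continuous_mul_log.comp_continuousOn (hc z)).mul (hζ.continuousOn z)

theorem relEnt_div_nonneg {m w : Z → ℝ} (hm : IsProb m) (hw : IsPosProb w) :
    0 ≤ relEnt w fun z => m z / w z := by
  have h : ∑ z, (m z / w z - 1) * w z = 0 := by
    rw [sum_congr rfl fun z _ => sub_mul (m z / w z) 1 (w z), sum_sub_distrib]
    have := expec_div m w hw.1
    simp only [expec] at this
    simp only [one_mul, this, hm.2, hw.2, sub_self]
  rw [← h]
  exact sum_le_sum fun z _ => mul_le_mul_of_nonneg_right
    (sub_one_le_mul_log (div_nonneg (hm.1 z) (hw.1 z).le)) (hw.1 z).le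

end Comparison

/-- uniform positive lower bound on the generalised functional
inequality constants along solutions of the forward Kolmogorov equation, and
the resulting exponential decay estimates comparing two solutions. -/
theorem long_time_comparison_estimates
    {Z : Type*} [Fintype Z] (hcard : 2 ≤ Fintype.card Z)
    (M : Z → Z → ℝ) (hgen : IsGenerator M) (hirr : IsIrreducibleGen M)
    (δ : ℝ) (hδ0 : 0 < δ) (hδ1 : δ < 1) :
    ∃ α : ℝ, 0 < α ∧
      ∀ (μ₀ ζ₀ : Z → ℝ), IsProb μ₀ → IsProb ζ₀ →
      ∀ (μ ζ : ℝ → Z → ℝ), μ 0 = μ₀ → ζ 0 = ζ₀ →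
        (∀ t ∈ Set.Ici (0 : ℝ), ∀ z : Z,
          HasDerivWithinAt (fun s => μ s z) (∑ z' : Z, M z' z * μ t z')
            (Set.Ici (0 : ℝ)) t) →
        (∀ t ∈ Set.Ici (0 : ℝ), ∀ z : Z,
          HasDerivWithinAt (fun s => ζ s z) (∑ z' : Z, M z' z * ζ t z')
            (Set.Ici (0 : ℝ)) t) →
        (∀ t : ℝ, 0 < t → IsPosProb (ζ t)) ∧
        (∀ t : ℝ, δ ≤ t → α ≤ gLSI (ζ t) M ∧ gLSI (ζ t) M ≤ 2 * gPI (ζ t) M) ∧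
        (IsPosProb ζ₀ → ∀ t : ℝ, 0 ≤ t →
          varWrt (ζ t) (fun z => μ t z / ζ t z) ≤
            varWrt ζ₀ (fun z => μ₀ z / ζ₀ z) *
              min 1 (Real.exp (-α * (t - δ))) ∧
          relEnt (ζ t) (fun z => μ t z / ζ t z) ≤
            relEnt ζ₀ (fun z => μ₀ z / ζ₀ z) *
              min 1 (Real.exp (-α * (t - δ)))) := by
  obtain ⟨c, hc, hlow⟩ := exists_forall_le_isForwardSolution hgen hirr hδ0
  obtain ⟨α, hα, hineq⟩ := exists_uniform_logSobolev hgen hirr hc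
  refine ⟨α, hα, ?_⟩
  rintro _ _ hμ0 hζ0 μ ζ rfl rfl hμ hζ
  replace hμ : IsForwardSolution M μ := hμ
  replace hζ : IsForwardSolution M ζ := hζ
  have hμt : ∀ t, 0 < t → IsPosProb (μ t) := fun t => hμ.isPosProb hgen hirr hμ0
  have hζt : ∀ t, 0 < t → IsPosProb (ζ t) := fun t => hζ.isPosProb hgen hirr hζ0
  have hζδ : ∀ t, δ ≤ t → ∀ z, c ≤ ζ t z := fun t ht => by
    have hs : 0 ≤ t - δ := sub_nonneg.2 ht
    have h := hlow _ (hζ.shift hs) (by simpa using hζ.isProb hgen hζ0 hs)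
    simpa using h
  refine ⟨hζt, fun t ht => ?_, fun hζpos t ht => ?_⟩
  · have hp := hζt t (hδ0.trans_le ht)
    exact ⟨le_gLSI hcard hp (hineq _ hp (hζδ t ht)).1, gLSI_le_two_mul_gPI hcard hgen hp⟩
  have hpos : ∀ t, 0 ≤ t → ∀ z, 0 < ζ t z := fun t ht => by
    rcases ht.eq_or_lt with rfl | ht
    exacts [hζpos.1, (hζt t ht).1]
  have hpos' : ∀ t, 0 < t → ∀ z, 0 < ζ t z := fun t ht => hpos t ht.le
  constructor
  · refine le_mul_min_one_exp hα.le hδ0 (continuousOn_varWrt_div hμ hζ hpos)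
      (fun s hs => hasDerivAt_varWrt_div hgen hμ hζ hμ0 hs hpos') (fun s hs => ?_)
      (fun s hs => ?_) (varWrt_nonneg hζpos _) ht
    · linarith [dirichletForm_nonneg hgen (fun z => (hpos' s hs z).le) fun z => μ s z / ζ s z]
    · linarith [(hineq _ (hζt s (hδ0.trans_le hs)) (hζδ s hs)).2 fun z => μ s z / ζ s z]
  · refine le_mul_min_one_exp hα.le hδ0 (continuousOn_relEnt_div hμ hζ hpos)
      (fun s hs => hasDerivAt_relEnt_div hgen hμ hζ hs (hμt s hs).1 hpos') (fun s hs => ?_)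
      (fun s hs => ?_) (relEnt_div_nonneg hμ0 hζpos) ht
    · exact neg_nonpos.2 (fisherInfo_nonneg hgen (hζt s hs) (isDensity_div (hμt s hs) (hζt s hs)))
    · have hs0 := hδ0.trans_le hs
      linarith [(hineq _ (hζt s hs0) (hζδ s hs)).1 _ (isDensity_div (hμt s hs0) (hζt s hs0))]
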